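/- arXiv:1804.00319 — 2 statements merged into one kernel-verified Lean document; each statement's English description precedes it below -/
import Mathlib

section
/- For all s ∈ S and all indices A,B,C one has (s̄^A Γ^μ s^B) Γ_μ s^C = 0. In particular the Dirac current κ of s, defined by κ^μ = ε_{AB} s̄^A Γ^μ s^B, Clifford-annihilates s: κ·s^C = 0 for all C. -/
/-!
Algebraic set-up for six-dimensional (1,0) spinor calculus.

`(V, η)` is the six-dimensional mostly-plus lorentzian vector space, realised as
`Fin 6 → ℝ` with metric `ηd = diag(-1,1,1,1,1,1)`.  The (complexified) Clifford
module `Σ` is realised as `Spinor8 = Fin 8 → ℂ`; the structure `CliffordData`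
packages gamma matrices satisfying the Clifford relation `v·v = η(v,v)𝟙`, the
symmetric spinor inner product `⟨-,-⟩` (given by the matrix `B`, symmetric,
nondegenerate, with `⟨v·s,t⟩ = -⟨s,v·t⟩`, and for which the chiral summands are
isotropic), and the quaternionic structure `J`.  `Δ` is the fundamental `Sp(1)`
module `Fin 2 → ℂ` with symplectic form `epsS` (`ε₁₂ = 1`), and an element of
the real representation `S` with `S ⊗ ℂ = Σ₊ ⊗ Δ` is a pair `s : Fin 2 → Spinor8`
of positive-chirality spinors satisfying the reality condition `IsS`.
-/

noncomputable section

open Matrix BigOperators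

/-- Spinors of the 8-dimensional complex Clifford module Σ. -/
abbrev Spinor8 := Fin 8 → ℂ

/-- Mostly-plus Minkowski metric `diag(-1,1,1,1,1,1)`. -/
def ηd (μ : Fin 6) : ℝ := if μ = 0 then -1 else 1

/-- The symplectic form ε on Δ, with `ε₁₂ = 1`. -/
def epsS (A B : Fin 2) : ℂ := if A = 0 ∧ B = 1 then 1 else if A = 1 ∧ B = 0 then -1 else 0

/-- The Levi-Civita symbol on six indices. -/
def eps6 (μ ν ρ σ τ υ : Fin 6) : ℝ :=
  (Matrix.of (fun i j => if (![μ, ν, ρ, σ, τ, υ] i) = j then (1 : ℝ) else 0) :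
    Matrix (Fin 6) (Fin 6) ℝ).det

/-- Data of the irreducible Clifford module Σ of `Cℓ(V)`, `V = ℝ^{5,1}`:
gamma matrices, the symmetric spinor pairing `B` and the quaternionic
structure `J`. -/
structure CliffordData where
  /-- gamma matrices `Γ_μ` -/
  Γ : Fin 6 → Matrix (Fin 8) (Fin 8) ℂ
  /-- the Clifford relation `Γ_μ Γ_ν + Γ_ν Γ_μ = 2 η_{μν} 𝟙` -/
  clifford : ∀ μ ν, Γ μ * Γ ν + Γ ν * Γ μ =
    (if μ = ν then 2 * (ηd μ : ℂ) else 0) • (1 : Matrix (Fin 8) (Fin 8) ℂ)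
  /-- matrix of the symmetric inner product `⟨-,-⟩`, `⟨s,t⟩ = sᵀ B t` -/
  B : Matrix (Fin 8) (Fin 8) ℂ
  B_symm : B.transpose = B
  B_nondeg : IsUnit B
  /-- `⟨v·s, t⟩ = -⟨s, v·t⟩` -/
  B_skew : ∀ μ, (Γ μ).transpose * B = - (B * Γ μ)
  /-- the chiral summands `Σ±` are isotropic for `⟨-,-⟩`:
      `⟨P₊s, P₊t⟩ = 0 = ⟨P₋s, P₋t⟩`, where `P± = ½(1 ± Γ₇)` -/
  B_iso_pos : ((1 : Matrix (Fin 8) (Fin 8) ℂ) + Γ 0 * Γ 1 * Γ 2 * Γ 3 * Γ 4 * Γ 5).transpose *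
      B * (1 + Γ 0 * Γ 1 * Γ 2 * Γ 3 * Γ 4 * Γ 5) = 0
  B_iso_neg : ((1 : Matrix (Fin 8) (Fin 8) ℂ) - Γ 0 * Γ 1 * Γ 2 * Γ 3 * Γ 4 * Γ 5).transpose *
      B * (1 - Γ 0 * Γ 1 * Γ 2 * Γ 3 * Γ 4 * Γ 5) = 0
  /-- quaternionic structure on Σ: the conjugate-linear map `s ↦ J (star s)` -/
  J : Matrix (Fin 8) (Fin 8) ℂ
  J_conj : ∀ μ, J * (Γ μ).map (starRingEnd ℂ) = Γ μ * J
  J_sq : J * J.map (starRingEnd ℂ) = -1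

namespace CliffordData

variable (d : CliffordData)

/-- the Clifford volume element `Γ₇ = Γ₀Γ₁Γ₂Γ₃Γ₄Γ₅` -/
def Γ7 : Matrix (Fin 8) (Fin 8) ℂ := d.Γ 0 * d.Γ 1 * d.Γ 2 * d.Γ 3 * d.Γ 4 * d.Γ 5

/-- gamma matrix with raised index, `Γ^μ = η^{μμ} Γ_μ` -/
def ΓU (μ : Fin 6) : Matrix (Fin 8) (Fin 8) ℂ := (ηd μ : ℂ) • d.Γ μ

/-- the pairing `s̄ t = ⟨s, t⟩` -/
def pair (s t : Spinor8) : ℂ := s ⬝ᵥ d.B.mulVec t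

/-- positive chirality: `Γ₇ s = s`, i.e. `s ∈ Σ₊` -/
def Pos (s : Spinor8) : Prop := d.Γ7.mulVec s = s

/-- the quaternionic conjugation on Σ -/
def conjS (s : Spinor8) : Spinor8 := d.J.mulVec fun a => (starRingEnd ℂ) (s a)

/-- membership in (the complexification of) the real form `S ⊂ Σ₊ ⊗ Δ`:
positive chirality together with the reality condition w.r.t. the
quaternionic structure `J ⊗ J_Δ` (`J_Δ` the standard one on `Δ`). -/
def IsS (s : Fin 2 → Spinor8) : Prop :=
  (∀ A, d.Pos (s A)) ∧ d.conjS (s 0) = s 1 ∧ d.conjS (s 1) = - s 0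

/-- antisymmetrised product `Γ_{μν}` -/
def Γ2 (μ ν : Fin 6) : Matrix (Fin 8) (Fin 8) ℂ :=
  (1 / 2 : ℂ) • (d.Γ μ * d.Γ ν - d.Γ ν * d.Γ μ)

/-- antisymmetrised product `Γ_{μνρ}` -/
def Γ3 (μ ν ρ : Fin 6) : Matrix (Fin 8) (Fin 8) ℂ :=
  (1 / 6 : ℂ) • (d.Γ μ * d.Γ ν * d.Γ ρ - d.Γ μ * d.Γ ρ * d.Γ ν
    + d.Γ ν * d.Γ ρ * d.Γ μ - d.Γ ν * d.Γ μ * d.Γ ρ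
    + d.Γ ρ * d.Γ μ * d.Γ ν - d.Γ ρ * d.Γ ν * d.Γ μ)

/-- the family of 3-forms `ω_{μνρ}{}^{AB} = s̄^A Γ_{μνρ} s^B` -/
def omega3 (s : Fin 2 → Spinor8) (A B : Fin 2) (μ ν ρ : Fin 6) : ℂ :=
  d.pair (s A) ((d.Γ3 μ ν ρ).mulVec (s B))

/-- the Dirac current `κ^μ = ε_{AB} s̄^A Γ^μ s^B` -/
def kappa (s : Fin 2 → Spinor8) (μ : Fin 6) : ℂ :=
  ∑ A, ∑ B, epsS A B * d.pair (s A) ((d.ΓU μ).mulVec (s B))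

end CliffordData

/-- Hodge star on 3-forms (components, indices down):
`(⋆T)_{μνρ} = (1/3!) ε_{μνρ}{}^{στυ} T_{στυ}`. -/
def hodge3C (T : Fin 6 → Fin 6 → Fin 6 → ℂ) (μ ν ρ : Fin 6) : ℂ :=
  (1 / 6 : ℂ) * ∑ σ, ∑ τ, ∑ υ,
    (eps6 μ ν ρ σ τ υ : ℂ) * (ηd σ : ℂ) * (ηd τ : ℂ) * (ηd υ : ℂ) * T σ τ υ

/-- (components of) an alternating 3-tensor -/
def Alt3 (T : Fin 6 → Fin 6 → Fin 6 → ℂ) : Prop :=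
  ∀ μ ν ρ, T ν μ ρ = - T μ ν ρ ∧ T μ ρ ν = - T μ ν ρ

/-- self-dual 3-form, `⋆T = T` -/
def SelfDual3 (T : Fin 6 → Fin 6 → Fin 6 → ℂ) : Prop :=
  ∀ μ ν ρ, hodge3C T μ ν ρ = T μ ν ρ

/-- antiself-dual 3-form, `⋆T = -T` -/
def AntiSelfDual3 (T : Fin 6 → Fin 6 → Fin 6 → ℂ) : Prop :=
  ∀ μ ν ρ, hodge3C T μ ν ρ = - T μ ν ρ

namespace CliffordData

theorem Γ_mul_of_lt (d : CliffordData) {i j : Fin 6} (h : j < i) :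
    d.Γ i * d.Γ j = -(d.Γ j * d.Γ i) := by
  have := d.clifford i j
  rw [if_neg h.ne', zero_smul] at this
  exact eq_neg_of_add_eq_zero_left this

theorem Γ_mul_mul_of_lt (d : CliffordData) {i j : Fin 6} (h : j < i)
    (x : Matrix (Fin 8) (Fin 8) ℂ) : d.Γ i * (d.Γ j * x) = -(d.Γ j * (d.Γ i * x)) := by
  rw [← mul_assoc, d.Γ_mul_of_lt h, neg_mul, mul_assoc]

theorem Γ_mul_self (d : CliffordData) (i : Fin 6) :
    d.Γ i * d.Γ i = (ηd i : ℂ) • (1 : Matrix (Fin 8) (Fin 8) ℂ) := by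
  have := d.clifford i i
  rw [if_pos rfl, ← two_smul ℂ, mul_smul] at this
  exact smul_right_injective _ (two_ne_zero (α := ℂ)) this

theorem Γ_mul_self_mul (d : CliffordData) (i : Fin 6) (x : Matrix (Fin 8) (Fin 8) ℂ) :
    d.Γ i * (d.Γ i * x) = (ηd i : ℂ) • x := by
  rw [← mul_assoc, d.Γ_mul_self, smul_mul_assoc, one_mul]

theorem Γ7_mul_self (d : CliffordData) : d.Γ7 * d.Γ7 = 1 := by
  simp [Γ7, mul_assoc, Γ_mul_mul_of_lt, Γ_mul_self, ηd]

theorem Γ7_mul_Γ (d : CliffordData) (μ : Fin 6) : d.Γ7 * d.Γ μ = -(d.Γ μ * d.Γ7) := by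
  fin_cases μ <;>
    simp [Γ7, mul_assoc, Γ_mul_of_lt, Γ_mul_mul_of_lt, Γ_mul_self, Γ_mul_self_mul, ηd]

theorem pair_Γ_comm (d : CliffordData) (μ : Fin 6) (a b : Spinor8) :
    d.pair a (d.Γ μ *ᵥ b) = -d.pair b (d.Γ μ *ᵥ a) := by
  unfold pair
  rw [mulVec_mulVec, mulVec_mulVec, dotProduct_comm, ← neg_eq_iff_eq_neg, ← neg_dotProduct,
    ← neg_mulVec, ← d.B_skew, ← d.B_symm, ← transpose_mul, mulVec_transpose,
    ← dotProduct_mulVec, d.B_symm]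

/-- Clifford multiplication on a fixed spinor `a`, as a linear map `v ↦ v · a` on complex
vectors. -/
def cliffordAct (d : CliffordData) (a : Spinor8) : (Fin 6 → ℂ) →ₗ[ℂ] Spinor8 :=
  ∑ μ, (LinearMap.proj μ : (Fin 6 → ℂ) →ₗ[ℂ] ℂ).smulRight (d.Γ μ *ᵥ a)

theorem cliffordAct_apply (d : CliffordData) (a : Spinor8) (v : Fin 6 → ℂ) :
    d.cliffordAct a v = ∑ μ, v μ • d.Γ μ *ᵥ a := by
  simp [cliffordAct]

theorem pair_cliffordAct_comm (d : CliffordData) (a b : Spinor8) (v : Fin 6 → ℂ) :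
    d.pair a (d.cliffordAct b v) = -d.pair b (d.cliffordAct a v) := by
  have h (x y : Spinor8) : d.pair x (d.cliffordAct y v) = ∑ μ, v μ * d.pair x (d.Γ μ *ᵥ y) := by
    simp [pair, cliffordAct_apply, mulVec_sum, dotProduct_sum, mulVec_smul]
  rw [h, h, ← Finset.sum_neg_distrib]
  exact Finset.sum_congr rfl fun μ _ => by rw [d.pair_Γ_comm, mul_neg]

theorem pair_cliffordAct_self (d : CliffordData) (a : Spinor8) (v : Fin 6 → ℂ) :
    d.pair a (d.cliffordAct a v) = 0 :=
  self_eq_neg.mp (d.pair_cliffordAct_comm a a v)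

/-- The complexified metric on `V`. -/
def metric : LinearMap.BilinForm ℂ (Fin 6 → ℂ) :=
  Matrix.toBilin' (Matrix.diagonal fun μ => (ηd μ : ℂ))

theorem metric_apply (v w : Fin 6 → ℂ) : metric v w = ∑ μ, (ηd μ : ℂ) * v μ * w μ := by
  simp [metric, Matrix.toBilin'_apply', dotProduct, mulVec_diagonal]
  exact Finset.sum_congr rfl fun μ _ => by ring

theorem metric_nondegenerate : metric.Nondegenerate := by
  refine Matrix.Nondegenerate.toBilin' (Matrix.nondegenerate_of_det_ne_zero ?_)
  rw [det_diagonal, Finset.prod_ne_zero_iff]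
  intro μ _
  unfold ηd
  split_ifs <;> simp

theorem cliffordAct_cliffordAct (d : CliffordData) (a : Spinor8) (v w : Fin 6 → ℂ) :
    d.cliffordAct (d.cliffordAct a w) v + d.cliffordAct (d.cliffordAct a v) w =
      (2 * metric v w) • a := by
  have h (x y : Fin 6 → ℂ) : d.cliffordAct (d.cliffordAct a y) x =
      ∑ μ, ∑ ν, (x μ * y ν) • (d.Γ μ * d.Γ ν) *ᵥ a := by
    simp [cliffordAct_apply, mulVec_sum, mulVec_smul, Finset.smul_sum, smul_smul]
  rw [h, h w v, Finset.sum_comm (f := fun μ ν => (w μ * v ν) • (d.Γ μ * d.Γ ν) *ᵥ a),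
    metric_apply, ← Finset.sum_add_distrib, Finset.mul_sum, Finset.sum_smul]
  refine Finset.sum_congr rfl fun μ _ => ?_
  have (ν : Fin 6) : (v μ * w ν) • (d.Γ μ * d.Γ ν) *ᵥ a + (w ν * v μ) • (d.Γ ν * d.Γ μ) *ᵥ a =
      if μ = ν then (2 * ((ηd μ : ℂ) * v μ * w ν)) • a else 0 := by
    rw [mul_comm (w ν), ← smul_add, ← add_mulVec, d.clifford, smul_mulVec, one_mulVec, smul_smul]
    split_ifs
    · congr 1; ring
    · simp
  simp [← Finset.sum_add_distrib, this]

theorem Γ7_mulVec_cliffordAct (d : CliffordData) {a : Spinor8} (ha : d.Pos a) (v : Fin 6 → ℂ) :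
    d.Γ7 *ᵥ d.cliffordAct a v = -d.cliffordAct a v := by
  simp only [cliffordAct_apply, mulVec_sum, mulVec_smul, mulVec_mulVec, d.Γ7_mul_Γ, neg_mulVec]
  simp only [← mulVec_mulVec, show d.Γ7 *ᵥ a = a from ha, smul_neg, Finset.sum_neg_distrib]

/-- The negative-chirality summand `Σ₋`. -/
def negSpinors (d : CliffordData) : Submodule ℂ Spinor8 :=
  LinearMap.ker (d.Γ7 + 1).mulVecLin

theorem mem_negSpinors (d : CliffordData) {a : Spinor8} :
    a ∈ d.negSpinors ↔ d.Γ7 *ᵥ a = -a := by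
  simp [negSpinors, eq_neg_iff_add_eq_zero]

theorem four_le_finrank_negSpinors (d : CliffordData) :
    4 ≤ Module.finrank ℂ d.negSpinors := by
  -- `Σ₊ = ker (Γ₇ - 1)` contains the range of `Γ₇ + 1` and `Γ₁` embeds it in `Σ₋`.
  have hrange : ∀ a ∈ LinearMap.range (d.Γ7 + 1).mulVecLin, d.Γ 1 *ᵥ a ∈ d.negSpinors := by
    rintro _ ⟨b, rfl⟩
    rw [mem_negSpinors, mulVec_mulVec, d.Γ7_mul_Γ, mulVecLin_apply, mulVec_mulVec, mulVec_mulVec,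
      neg_mul, neg_mulVec, mul_assoc, mul_add, d.Γ7_mul_self, mul_one, add_comm]
  have hinj : Function.Injective
      ((d.Γ 1).mulVecLin.restrict (p := LinearMap.range (d.Γ7 + 1).mulVecLin) hrange) := by
    intro x y hxy
    have h : d.Γ 1 *ᵥ d.Γ 1 *ᵥ (x : Spinor8) = d.Γ 1 *ᵥ d.Γ 1 *ᵥ (y : Spinor8) :=
      congrArg (fun z : d.negSpinors => d.Γ 1 *ᵥ (z : Spinor8)) hxy
    rw [mulVec_mulVec, mulVec_mulVec, d.Γ_mul_self] at h
    exact Subtype.ext (by simpa only [ηd, one_ne_zero, if_false, Complex.ofReal_one, one_smul,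
      one_mulVec] using h)
  have hle : Module.finrank ℂ (LinearMap.range (d.Γ7 + 1).mulVecLin) ≤
      Module.finrank ℂ d.negSpinors := LinearMap.finrank_le_finrank_of_injective hinj
  have hsum : Module.finrank ℂ (LinearMap.range (d.Γ7 + 1).mulVecLin) +
      Module.finrank ℂ d.negSpinors = 8 :=
    (LinearMap.finrank_range_add_finrank_ker _).trans (Module.finrank_fin_fun ℂ)
  omega

theorem pair_negSpinors (d : CliffordData) {a b : Spinor8} (ha : a ∈ d.negSpinors)
    (hb : b ∈ d.negSpinors) : d.pair a b = 0 := by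
  have hproj {c : Spinor8} (hc : c ∈ d.negSpinors) : (1 - d.Γ7) *ᵥ c = (2 : ℂ) • c := by
    rw [sub_mulVec, one_mulVec, d.mem_negSpinors.mp hc, sub_neg_eq_add, two_smul]
  have h : ((1 - d.Γ7) *ᵥ a) ⬝ᵥ d.B *ᵥ ((1 - d.Γ7) *ᵥ b) = 0 := by
    rw [← vecMul_transpose, ← dotProduct_mulVec, mulVec_mulVec, mulVec_mulVec,
      show (1 - d.Γ7)ᵀ * d.B * (1 - d.Γ7) = 0 from d.B_iso_neg]
    simp
  rw [hproj ha, hproj hb] at h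
  simpa [mulVec_smul, pair] using h

theorem toBilin'_B_apply (d : CliffordData) (a b : Spinor8) :
    Matrix.toBilin' d.B a b = d.pair a b :=
  Matrix.toBilin'_apply' ..

/-- A nonzero positive-chirality spinor is pure: its annihilator has dimension at least three. -/
theorem three_le_finrank_ker_cliffordAct (d : CliffordData) {a : Spinor8} (ha : d.Pos a)
    (ha0 : a ≠ 0) : 3 ≤ Module.finrank ℂ (LinearMap.ker (d.cliffordAct a)) := by
  have hnot : a ∉ d.negSpinors := fun h =>
    ha0 (self_eq_neg.mp ((show d.Γ7 *ᵥ a = a from ha).symm.trans (d.mem_negSpinors.mp h)))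
  have hdisj : d.negSpinors ⊓ Submodule.span ℂ {a} = ⊥ :=
    disjoint_iff.mp ((Submodule.disjoint_span_singleton' ha0).mpr hnot)
  have hsup : Module.finrank ℂ ↥(d.negSpinors ⊔ Submodule.span ℂ {a}) =
      Module.finrank ℂ d.negSpinors + 1 := by
    have h := Submodule.finrank_sup_add_finrank_inf_eq d.negSpinors (Submodule.span ℂ {a})
    rwa [hdisj, finrank_bot, finrank_span_singleton ha0] at h
  have hnondeg : (Matrix.toBilin' d.B).Nondegenerate :=
    Matrix.Nondegenerate.toBilin' (Matrix.nondegenerate_of_det_ne_zero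
      ((Matrix.isUnit_iff_isUnit_det _).mp d.B_nondeg).ne_zero)
  have hrange : LinearMap.range (d.cliffordAct a) ≤
      (Matrix.toBilin' d.B).orthogonal (d.negSpinors ⊔ Submodule.span ℂ {a}) := by
    rintro _ ⟨v, rfl⟩ x hx
    obtain ⟨n, hn, m, hm, rfl⟩ := Submodule.mem_sup.mp hx
    obtain ⟨c, rfl⟩ := Submodule.mem_span_singleton.mp hm
    have h₁ := d.pair_negSpinors hn (d.mem_negSpinors.mpr (d.Γ7_mulVec_cliffordAct ha v))
    have h₂ := d.pair_cliffordAct_self a v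
    rw [← toBilin'_B_apply] at h₁ h₂
    simp [h₁, h₂]
  have hle : Module.finrank ℂ (LinearMap.range (d.cliffordAct a)) ≤
      8 - Module.finrank ℂ ↥(d.negSpinors ⊔ Submodule.span ℂ {a}) := by
    have h := Submodule.finrank_mono hrange
    rwa [LinearMap.BilinForm.finrank_orthogonal hnondeg, Module.finrank_fin_fun] at h
  have hsum : Module.finrank ℂ (LinearMap.range (d.cliffordAct a)) +
      Module.finrank ℂ (LinearMap.ker (d.cliffordAct a)) = 6 :=
    (LinearMap.finrank_range_add_finrank_ker _).trans (Module.finrank_fin_fun ℂ)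
  have := d.four_le_finrank_negSpinors
  omega

/-- The annihilator of a nonzero positive-chirality spinor is its own orthogonal complement. -/
theorem orthogonal_ker_cliffordAct (d : CliffordData) {a : Spinor8} (ha : d.Pos a)
    (ha0 : a ≠ 0) :
    metric.orthogonal (LinearMap.ker (d.cliffordAct a)) = LinearMap.ker (d.cliffordAct a) := by
  have hle : LinearMap.ker (d.cliffordAct a) ≤
      metric.orthogonal (LinearMap.ker (d.cliffordAct a)) := by
    intro w hw v hv
    have h := d.cliffordAct_cliffordAct a v w
    rw [LinearMap.mem_ker.mp hv, LinearMap.mem_ker.mp hw] at h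
    simpa [cliffordAct_apply, ha0] using h.symm
  refine (Submodule.eq_of_le_of_finrank_le hle ?_).symm
  rw [LinearMap.BilinForm.finrank_orthogonal metric_nondegenerate,
    Module.finrank_fin_fun]
  have := d.three_le_finrank_ker_cliffordAct ha ha0
  omega

/-- The vector `āΓ^μ b` Clifford-annihilates `a`. -/
theorem sum_pair_smul_mulVec_left (d : CliffordData) {a : Spinor8} (ha : d.Pos a)
    (b : Spinor8) : ∑ μ, d.pair a (d.ΓU μ *ᵥ b) • d.Γ μ *ᵥ a = 0 := by
  rcases eq_or_ne a 0 with rfl | ha0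
  · simp
  rw [← cliffordAct_apply, ← LinearMap.mem_ker, ← d.orthogonal_ker_cliffordAct ha ha0]
  intro v hv
  change metric _ _ = 0
  rw [metric_apply]
  have hη (μ : Fin 6) : (ηd μ : ℂ) * ηd μ = 1 := by
    unfold ηd
    split_ifs <;> simp
  calc ∑ μ, (ηd μ : ℂ) * v μ * d.pair a (d.ΓU μ *ᵥ b)
      = d.pair a (d.cliffordAct b v) := by
        simp only [pair, cliffordAct_apply, ΓU, mulVec_sum, dotProduct_sum, mulVec_smul,
          smul_mulVec, dotProduct_smul, smul_eq_mul]
        exact Finset.sum_congr rfl fun μ _ => by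
          linear_combination (v μ * (a ⬝ᵥ d.B *ᵥ d.Γ μ *ᵥ b)) * hη μ
    _ = 0 := by
        rw [pair_cliffordAct_comm, LinearMap.mem_ker.mp hv]
        simp [pair]

theorem pair_ΓU_comm (d : CliffordData) (μ : Fin 6) (a b : Spinor8) :
    d.pair a (d.ΓU μ *ᵥ b) = -d.pair b (d.ΓU μ *ᵥ a) := by
  have h := d.pair_Γ_comm μ a b
  simp only [pair, ΓU, smul_mulVec, mulVec_smul, dotProduct_smul, smul_eq_mul] at h ⊢
  rw [h, mul_neg]

theorem sum_pair_smul_mulVec (d : CliffordData) {s : Fin 2 → Spinor8} (hs : ∀ A, d.Pos (s A))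
    (A B C : Fin 2) : ∑ μ, d.pair (s A) (d.ΓU μ *ᵥ s B) • d.Γ μ *ᵥ s C = 0 := by
  have hcases : C = A ∨ C = B ∨ A = B := by omega
  rcases hcases with rfl | rfl | rfl
  · exact d.sum_pair_smul_mulVec_left (hs C) (s B)
  · have h := d.sum_pair_smul_mulVec_left (hs C) (s A)
    simp only [d.pair_ΓU_comm _ (s A), neg_smul, Finset.sum_neg_distrib, h, neg_zero]
  · simp [self_eq_neg.mp (d.pair_ΓU_comm _ (s A) (s A))]

end CliffordData

/-- For all `s ∈ S` and all indices `A, B, C`,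
`(s̄^A Γ^μ s^B) Γ_μ s^C = 0` (sum over `μ`).  In particular the Dirac current
`κ`, with `κ^μ = ε_{AB} s̄^A Γ^μ s^B`, Clifford-annihilates `s`:
`κ · s^C = 0` for all `C`. -/
theorem dirac_current_clifford_annihilates (d : CliffordData) (s : Fin 2 → Spinor8)
    (hs : d.IsS s) :
    (∀ A B C, (∑ μ, d.pair (s A) ((d.ΓU μ).mulVec (s B)) • (d.Γ μ).mulVec (s C)) = 0) ∧
    (∀ C, (∑ μ, d.kappa s μ • (d.Γ μ).mulVec (s C)) = 0) := by
  have h := d.sum_pair_smul_mulVec hs.1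
  refine ⟨h, fun C => ?_⟩
  simp only [CliffordData.kappa, Finset.sum_smul, mul_smul]
  rw [Finset.sum_comm]
  refine Finset.sum_eq_zero fun A _ => ?_
  rw [Finset.sum_comm]
  refine Finset.sum_eq_zero fun B _ => ?_
  rw [← Finset.smul_sum, h, smul_zero]
end
end

section
/- Let s ∈ S be non-zero, with Dirac current κ (κ^μ = ε_{AB} s̄^A Γ^μ s^B) and 3-forms ω^{AB} (ω_{μνρ}^{AB} = s̄^A Γ_{μνρ} s^B). Then (i) κ is a non-vanishing null vector, and (ii) the three 3-forms ω^{11}, ω^{12}, ω^{22} are linearly independent; in particular none of them vanishes. -/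
/-!
Algebraic set-up for six-dimensional (1,0) spinor calculus.

`(V, η)` is the six-dimensional mostly-plus lorentzian vector space, realised as
`Fin 6 → ℝ` with metric `ηd = diag(-1,1,1,1,1,1)`.  The (complexified) Clifford
module `Σ` is realised as `Spinor8 = Fin 8 → ℂ`; the structure `CliffordData`
packages gamma matrices satisfying the Clifford relation `v·v = η(v,v)𝟙`, the
symmetric spinor inner product `⟨-,-⟩` (given by the matrix `B`, symmetric,
nondegenerate, with `⟨v·s,t⟩ = -⟨s,v·t⟩`, and for which the chiral summands are
isotropic), and the quaternionic structure `J`.  `Δ` is the fundamental `Sp(1)`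
module `Fin 2 → ℂ` with symplectic form `epsS` (`ε₁₂ = 1`), and an element of
the real representation `S` with `S ⊗ ℂ = Σ₊ ⊗ Δ` is a pair `s : Fin 2 → Spinor8`
of positive-chirality spinors satisfying the reality condition `IsS`.
-/

noncomputable section

open Matrix BigOperators

namespace CliffordData

variable (d : CliffordData)

/-- The sign by which `Γ_i` commutes past the factor of `basisProd S` at position `j`. -/
def factorSign (S : Fin 6 → Bool) (i j : Fin 6) : ℂ := if S j = true ∧ i ≠ j then -1 else 1

/-- The parity by which `Γ_i` fails to commute with `basisProd S`. -/
def commParity (S : Fin 6 → Bool) (i : Fin 6) : Bool :=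
  (S 0 && !decide (i = 0)) ^^ (S 1 && !decide (i = 1)) ^^ (S 2 && !decide (i = 2)) ^^
    (S 3 && !decide (i = 3)) ^^ (S 4 && !decide (i = 4)) ^^ (S 5 && !decide (i = 5))

/-- The factor `Γ_j` or `1` of `basisProd S`. -/
def basisFactor (S : Fin 6 → Bool) (j : Fin 6) : Matrix (Fin 8) (Fin 8) ℂ :=
  if S j then d.Γ j else 1

/-- The ordered product of the gamma matrices selected by `S`. -/
def basisProd (S : Fin 6 → Bool) : Matrix (Fin 8) (Fin 8) ℂ :=
  d.basisFactor S 0 * d.basisFactor S 1 * d.basisFactor S 2 * d.basisFactor S 3 *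
    d.basisFactor S 4 * d.basisFactor S 5

theorem Γ_anticomm {i j : Fin 6} (h : i ≠ j) : d.Γ i * d.Γ j = -(d.Γ j * d.Γ i) := by
  have := d.clifford i j
  rw [if_neg h, zero_smul] at this
  exact eq_neg_of_add_eq_zero_left this

theorem Γ_sq (i : Fin 6) : d.Γ i * d.Γ i = (ηd i : ℂ) • (1 : Matrix (Fin 8) (Fin 8) ℂ) := by
  have := d.clifford i i
  rw [if_pos rfl, ← two_smul ℂ, mul_smul] at this
  exact smul_right_injective _ (two_ne_zero (α := ℂ)) this

theorem ηd_mul_self (i : Fin 6) : (ηd i : ℂ) * (ηd i : ℂ) = 1 := by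
  unfold ηd; split_ifs <;> norm_num

theorem isUnit_Γ (i : Fin 6) : IsUnit (d.Γ i) := by
  have h : d.Γ i * ((ηd i : ℂ) • d.Γ i) = 1 := by
    rw [mul_smul_comm, Γ_sq, smul_smul, ηd_mul_self, one_smul]
  exact IsUnit.of_mul_eq_one _ h

theorem isUnit_basisProd (S : Fin 6 → Bool) : IsUnit (d.basisProd S) := by
  have h (j) : IsUnit (d.basisFactor S j) := by
    unfold basisFactor; split_ifs
    exacts [d.isUnit_Γ j, isUnit_one]
  exact (((((h 0).mul (h 1)).mul (h 2)).mul (h 3)).mul (h 4)).mul (h 5)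

theorem mul_mul_sign_comm {x a b : Matrix (Fin 8) (Fin 8) ℂ} {α β : ℂ}
    (ha : x * a = α • (a * x)) (hb : x * b = β • (b * x)) :
    x * (a * b) = (α * β) • (a * b * x) := by
  rw [← mul_assoc, ha, smul_mul_assoc, mul_assoc, hb, mul_smul_comm, smul_smul, ← mul_assoc]

theorem Γ_mul_basisFactor (S : Fin 6 → Bool) (i j : Fin 6) :
    d.Γ i * d.basisFactor S j = factorSign S i j • (d.basisFactor S j * d.Γ i) := by
  unfold basisFactor factorSign
  by_cases hS : S j = true <;> by_cases hij : i = j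
  · simp [hS, hij]
  · simp [hS, hij, d.Γ_anticomm hij]
  · simp [hS]
  · simp [hS]

theorem Γ_mul_basisProd (S : Fin 6 → Bool) (i : Fin 6) :
    d.Γ i * d.basisProd S =
      (if commParity S i then (-1 : ℂ) else 1) • (d.basisProd S * d.Γ i) := by
  have h := d.Γ_mul_basisFactor S i
  have h' := mul_mul_sign_comm (mul_mul_sign_comm (mul_mul_sign_comm (mul_mul_sign_comm
    (mul_mul_sign_comm (h 0) (h 1)) (h 2)) (h 3)) (h 4)) (h 5)
  have hs (j) : factorSign S i j = if (S j && !decide (i = j)) then (-1 : ℂ) else 1 := by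
    simp [factorSign]
  have hx (a b : Bool) : (if a then (-1 : ℂ) else 1) * (if b then (-1 : ℂ) else 1) =
      if (a ^^ b) then (-1 : ℂ) else 1 := by
    cases a <;> cases b <;> simp
  simp only [hs, hx] at h'
  exact h'

theorem eq_vec_six {α : Type*} (S : Fin 6 → α) : S = ![S 0, S 1, S 2, S 3, S 4, S 5] := by
  funext j
  fin_cases j <;> rfl

theorem commParity_injective : Function.Injective commParity := by
  refine Function.LeftInverse.injective
    (g := fun m i => m 0 ^^ m 1 ^^ m 2 ^^ m 3 ^^ m 4 ^^ m 5 ^^ m i) fun S => ?_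
  have key : ∀ a b c e f g : Bool, ∀ i,
      (fun m i => m 0 ^^ m 1 ^^ m 2 ^^ m 3 ^^ m 4 ^^ m 5 ^^ m i)
      (commParity ![a, b, c, e, f, g]) i = ![a, b, c, e, f, g] i := by decide
  rw [eq_vec_six S]
  exact funext (key _ _ _ _ _ _)

theorem trace_eq_zero_of_anticomm {x M : Matrix (Fin 8) (Fin 8) ℂ} (hx : IsUnit x)
    (h : x * M = -(M * x)) : M.trace = 0 := by
  obtain ⟨u, rfl⟩ := hx
  have h1 : M = -((u⁻¹ : (Matrix (Fin 8) (Fin 8) ℂ)ˣ) * M * u) := by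
    rw [mul_assoc, ← mul_neg, ← h, ← mul_assoc, Units.inv_mul, one_mul]
  have h2 := congrArg trace h1
  rw [trace_neg, trace_mul_comm, ← mul_assoc, Units.mul_inv, one_mul] at h2
  linear_combination h2 / 2

theorem trace_inv_mul_basisProd {S T : Fin 6 → Bool} (hST : S ≠ T)
    {N : Matrix (Fin 8) (Fin 8) ℂ} (hN : N * d.basisProd T = 1) :
    (N * d.basisProd S).trace = 0 := by
  have hN' : d.basisProd T * N = 1 := mul_eq_one_comm.mp hN
  obtain ⟨i, hi⟩ := Function.ne_iff.mp (commParity_injective.ne hST)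
  refine trace_eq_zero_of_anticomm (d.isUnit_Γ i) ?_
  set τ : ℂ := if commParity T i then -1 else 1 with hτ
  have hT : N * d.Γ i = τ • (d.Γ i * N) := by
    calc N * d.Γ i = N * (d.Γ i * d.basisProd T) * N := by
          rw [mul_assoc, mul_assoc, hN', mul_one]
      _ = _ := by
        rw [d.Γ_mul_basisProd T i, mul_smul_comm, ← mul_assoc, hN, one_mul, smul_mul_assoc]
  have hττ : τ * τ = 1 := by rw [hτ]; split_ifs <;> norm_num
  have hT' : d.Γ i * N = τ • (N * d.Γ i) := by rw [hT, smul_smul, hττ, one_smul]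
  rw [mul_mul_sign_comm hT' (d.Γ_mul_basisProd S i), ← neg_one_smul ℂ, hτ]
  revert hi
  cases commParity S i <;> cases commParity T i <;> simp

theorem linearIndependent_basisProd : LinearIndependent ℂ d.basisProd := by
  rw [Fintype.linearIndependent_iff]
  intro g hg T
  obtain ⟨N, hN⟩ := (d.isUnit_basisProd T).exists_left_inv
  have h := congrArg (fun M => (N * M).trace) hg
  simp only [Finset.mul_sum, trace_sum, mul_smul_comm, trace_smul, mul_zero, trace_zero] at h
  rw [Finset.sum_eq_single T (fun S _ hS => by rw [d.trace_inv_mul_basisProd hS hN, smul_zero])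
    (fun h => absurd (Finset.mem_univ T) h), hN] at h
  simpa using h

theorem span_basisProd : Submodule.span ℂ (Set.range d.basisProd) = ⊤ :=
  d.linearIndependent_basisProd.span_eq_top_of_card_eq_finrank' (by
    simp [Module.finrank_matrix])

theorem eq_zero_of_trace_mul_basisProd {Y : Matrix (Fin 8) (Fin 8) ℂ}
    (h : ∀ S, (Y * d.basisProd S).trace = 0) : Y = 0 := by
  refine ext_iff_trace_mul_right.mpr fun M => ?_
  have hM : M ∈ Submodule.span ℂ (Set.range d.basisProd) := by simp [d.span_basisProd]
  rw [zero_mul, trace_zero]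
  induction hM using Submodule.span_induction with
  | mem x hx => obtain ⟨S, rfl⟩ := hx; exact h S
  | zero => simp
  | add x y _ _ hx hy => rw [mul_add, trace_add, hx, hy, add_zero]
  | smul a x _ hx => rw [mul_smul_comm, trace_smul, hx, smul_zero]

theorem transpose_Γ7_mul_B : d.Γ7ᵀ * d.B = -(d.B * d.Γ7) := by
  have hp : (1 + d.Γ7)ᵀ * d.B * (1 + d.Γ7) = 0 := d.B_iso_pos
  have hn : (1 - d.Γ7)ᵀ * d.B * (1 - d.Γ7) = 0 := d.B_iso_neg
  have h : (2 : ℂ) • (d.Γ7ᵀ * d.B + d.B * d.Γ7) = 0 := by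
    rw [← sub_self (0 : Matrix (Fin 8) (Fin 8) ℂ)]
    nth_rw 1 [← hp]
    rw [← hn, transpose_add, transpose_sub, transpose_one, two_smul]
    noncomm_ring
  exact eq_neg_of_add_eq_zero_left ((smul_eq_zero.mp h).resolve_left two_ne_zero)

theorem Γ7_sq : d.Γ7 * d.Γ7 = 1 := by
  have hp : (1 + d.Γ7)ᵀ * d.B * (1 + d.Γ7) = 0 := d.B_iso_pos
  have h : d.B * (1 - d.Γ7 * d.Γ7) = 0 := by
    rw [transpose_add, transpose_one, add_mul, one_mul, transpose_Γ7_mul_B] at hp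
    rw [← hp]
    noncomm_ring
  have := (d.B_nondeg.mul_right_eq_zero).mp h
  exact (sub_eq_zero.mp this).symm

theorem Γ7_eq_basisProd : d.Γ7 = d.basisProd fun _ => true := by
  simp [Γ7, basisProd, basisFactor]

theorem Γ_mul_Γ7 (i : Fin 6) : d.Γ i * d.Γ7 = -(d.Γ7 * d.Γ i) := by
  rw [Γ7_eq_basisProd, Γ_mul_basisProd]
  fin_cases i <;> simp [commParity]

theorem Γ_mul_Γ_mul_Γ7 (i j : Fin 6) : d.Γ i * d.Γ j * d.Γ7 = d.Γ7 * (d.Γ i * d.Γ j) := by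
  rw [mul_assoc, Γ_mul_Γ7, mul_neg, ← mul_assoc, Γ_mul_Γ7, neg_mul, neg_neg, mul_assoc]

section Chiral

variable {d} {Y : Matrix (Fin 8) (Fin 8) ℂ}

theorem trace_mul_eq_zero_of_commute_Γ7 (hl : d.Γ7 * Y = Y) (hr : Y * d.Γ7 = -Y)
    {M : Matrix (Fin 8) (Fin 8) ℂ} (hM : M * d.Γ7 = d.Γ7 * M) : (Y * M).trace = 0 := by
  have h : (Y * M).trace = -(Y * M).trace := by
    nth_rw 1 [← hl]
    rw [mul_assoc, trace_mul_comm, mul_assoc, hM, ← mul_assoc, hr, neg_mul, trace_neg]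
  linear_combination h / 2

theorem trace_mul_Γ7_mul (hr : Y * d.Γ7 = -Y) {M : Matrix (Fin 8) (Fin 8) ℂ}
    (hM : (Y * M).trace = 0) : (Y * (d.Γ7 * M)).trace = 0 := by
  rw [← mul_assoc, hr, neg_mul, trace_neg, hM, neg_zero]

theorem trace_mul_basisProd_ne (hr : Y * d.Γ7 = -Y) (h1 : ∀ μ, (Y * d.Γ μ).trace = 0)
    (i : Fin 6) : (Y * d.basisProd fun j => !decide (j = i)).trace = 0 := by
  set P := d.basisProd fun j => decide (j < i)
  set Q := d.basisProd fun j => decide (i < j)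
  have h7 : d.Γ7 = P * d.Γ i * Q := by
    fin_cases i <;> simp [P, Q, Γ7, basisProd, basisFactor, mul_assoc]
  have hPQ : (d.basisProd fun j => !decide (j = i)) = P * Q := by
    fin_cases i <;> simp [P, Q, basisProd, basisFactor, mul_assoc]
  have hP : d.Γ i * P = _ := d.Γ_mul_basisProd _ i
  have h : d.Γ7 * d.Γ i = -((if commParity (fun j => decide (j < i)) i then (-1 : ℂ) else 1) •
      (ηd i : ℂ) • (P * Q)) := by
    rw [← neg_eq_iff_eq_neg, ← Γ_mul_Γ7, h7, ← mul_assoc, ← mul_assoc, hP]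
    simp only [smul_mul_assoc, mul_assoc P, Γ_sq, mul_smul_comm, mul_one, P]
  have h' := trace_mul_Γ7_mul hr (h1 i)
  rw [h, mul_neg, mul_smul_comm, mul_smul_comm, trace_neg, trace_smul, trace_smul, neg_eq_zero,
    smul_eq_zero, smul_eq_zero] at h'
  rw [hPQ]
  refine (h'.resolve_left ?_).resolve_left fun h0 => ?_
  · split_ifs <;> norm_num
  · simpa [h0] using ηd_mul_self i

theorem eq_zero_of_chiral (hl : d.Γ7 * Y = Y) (hr : Y * d.Γ7 = -Y)
    (h1 : ∀ μ, (Y * d.Γ μ).trace = 0)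
    (h3 : ∀ μ ν ρ, μ ≠ ν → μ ≠ ρ → ν ≠ ρ → (Y * (d.Γ μ * d.Γ ν * d.Γ ρ)).trace = 0) :
    Y = 0 := by
  refine d.eq_zero_of_trace_mul_basisProd fun S => ?_
  have h2 (i j) := trace_mul_eq_zero_of_commute_Γ7 hl hr (d.Γ_mul_Γ_mul_Γ7 i j)
  have h0 : (Y * 1).trace = 0 := trace_mul_eq_zero_of_commute_Γ7 hl hr (by simp)
  have h4 (i j k l) : (Y * (d.Γ i * d.Γ j * d.Γ k * d.Γ l)).trace = 0 := by
    refine trace_mul_eq_zero_of_commute_Γ7 hl hr ?_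
    rw [mul_assoc (d.Γ i * d.Γ j), mul_assoc, Γ_mul_Γ_mul_Γ7, ← mul_assoc, Γ_mul_Γ_mul_Γ7,
      mul_assoc]
  have h6 : (Y * (d.Γ 0 * d.Γ 1 * d.Γ 2 * d.Γ 3 * d.Γ 4 * d.Γ 5)).trace = 0 :=
    trace_mul_eq_zero_of_commute_Γ7 hl hr (M := d.Γ7) rfl
  have h5 (i) := trace_mul_basisProd_ne hr h1 i
  have e0 := h5 0
  have e1 := h5 1
  have e2 := h5 2
  have e3 := h5 3
  have e4 := h5 4
  have e5 := h5 5
  simp only [basisProd, basisFactor, decide_true, Fin.reduceEq, decide_false, Bool.not_true,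
    Bool.not_false, if_true, if_false, one_mul, mul_one, Bool.false_eq_true] at e0 e1 e2 e3 e4 e5 h0
  rw [eq_vec_six S]
  cases S 0 <;> cases S 1 <;> cases S 2 <;> cases S 3 <;> cases S 4 <;> cases S 5 <;>
    simp [basisProd, basisFactor, h0, h1, h2, h3, h4, e0, e1, e2, e3, e4, e5, h6]

theorem transpose_Γ_mul_Γ_mul_Γ_mul_B {μ ν ρ : Fin 6} (h₁ : μ ≠ ν) (h₂ : μ ≠ ρ) (h₃ : ν ≠ ρ) :
    (d.Γ μ * d.Γ ν * d.Γ ρ)ᵀ * d.B = d.B * (d.Γ μ * d.Γ ν * d.Γ ρ) := by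
  have hrev : d.Γ ρ * d.Γ ν * d.Γ μ = -(d.Γ μ * d.Γ ν * d.Γ ρ) := by
    rw [d.Γ_anticomm h₃.symm, neg_mul, mul_assoc, d.Γ_anticomm h₂.symm, mul_neg, neg_neg,
      ← mul_assoc, d.Γ_anticomm h₁.symm, neg_mul]
  rw [transpose_mul, transpose_mul, mul_assoc, mul_assoc, d.B_skew μ, mul_neg, ← mul_assoc (d.Γ ν)ᵀ,
    d.B_skew ν, neg_mul, neg_neg, mul_assoc, ← mul_assoc, d.B_skew ρ, neg_mul, mul_assoc,
    ← mul_assoc (d.Γ ρ), hrev, mul_neg, neg_neg]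

theorem trace_mul_of_transpose_mul_B {σ τ : ℂ} {M : Matrix (Fin 8) (Fin 8) ℂ}
    (hY : Yᵀ * d.B = σ • (d.B * Y)) (hM : Mᵀ * d.B = τ • (d.B * M)) :
    (Y * M).trace = σ * τ * (Y * M).trace := by
  obtain ⟨C, hC⟩ := d.B_nondeg.exists_right_inv
  have hC' : C * d.B = 1 := mul_eq_one_comm.mp hC
  calc (Y * M).trace = (Mᵀ * (Yᵀ * d.B) * C).trace := by
        rw [← trace_transpose, transpose_mul, mul_assoc, mul_assoc, hC, mul_one]
    _ = σ * (Mᵀ * d.B * Y * C).trace := by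
        rw [hY, mul_smul_comm, smul_mul_assoc, trace_smul, smul_eq_mul, ← mul_assoc]
    _ = σ * (τ * (C * d.B * (M * Y)).trace) := by
        rw [hM, smul_mul_assoc, smul_mul_assoc, trace_smul, smul_eq_mul, trace_mul_comm _ C]
        simp only [mul_assoc]
    _ = σ * τ * (Y * M).trace := by rw [hC', one_mul, trace_mul_comm, mul_assoc]

theorem eq_zero_of_chiral_of_skew (hl : d.Γ7 * Y = Y) (hr : Y * d.Γ7 = -Y)
    (hY : Yᵀ * d.B = -(d.B * Y)) (h1 : ∀ μ, (Y * d.Γ μ).trace = 0) : Y = 0 := by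
  refine eq_zero_of_chiral hl hr h1 fun μ ν ρ h₁ h₂ h₃ => ?_
  have := trace_mul_of_transpose_mul_B (σ := -1) (τ := 1) (by simpa using hY)
    ((transpose_Γ_mul_Γ_mul_Γ_mul_B h₁ h₂ h₃).trans (one_smul ℂ _).symm)
  linear_combination this / 2

theorem eq_zero_of_chiral_of_symm (hl : d.Γ7 * Y = Y) (hr : Y * d.Γ7 = -Y)
    (hY : Yᵀ * d.B = d.B * Y)
    (h3 : ∀ μ ν ρ, μ ≠ ν → μ ≠ ρ → ν ≠ ρ → (Y * (d.Γ μ * d.Γ ν * d.Γ ρ)).trace = 0) :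
    Y = 0 := by
  refine eq_zero_of_chiral hl hr (fun μ => ?_) h3
  have := trace_mul_of_transpose_mul_B (σ := 1) (τ := -1) (by simpa using hY)
    (by simpa using d.B_skew μ)
  linear_combination this / 2

end Chiral

/-- The rank-one endomorphism `a b̄` of `Σ`. -/
def outer (a b : Spinor8) : Matrix (Fin 8) (Fin 8) ℂ := vecMulVec a b * d.B

theorem trace_outer_mul (a b : Spinor8) (M : Matrix (Fin 8) (Fin 8) ℂ) :
    (d.outer a b * M).trace = d.pair b (M *ᵥ a) := by
  rw [outer, mul_assoc, vecMulVec_mul, trace_vecMulVec, dotProduct_comm, pair, dotProduct_mulVec,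
    dotProduct_mulVec, vecMul_vecMul]

theorem outer_mulVec (a b t : Spinor8) : d.outer a b *ᵥ t = d.pair b t • a := by
  rw [outer, ← mulVec_mulVec, vecMulVec_mulVec, pair]
  ext i
  simp [mul_comm]

theorem transpose_outer_mul_B (a b : Spinor8) : (d.outer a b)ᵀ * d.B = d.B * d.outer b a := by
  rw [outer, outer, transpose_mul, transpose_vecMulVec, d.B_symm, mul_assoc]

theorem Γ7_mul_outer {a : Spinor8} (ha : d.Pos a) (b : Spinor8) :
    d.Γ7 * d.outer a b = d.outer a b := by
  rw [outer, ← mul_assoc, mul_vecMulVec, ha]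

theorem outer_mul_Γ7 (a : Spinor8) {b : Spinor8} (hb : d.Pos b) :
    d.outer a b * d.Γ7 = -d.outer a b := by
  rw [outer, mul_assoc, ← neg_eq_iff_eq_neg, ← mul_neg, ← transpose_Γ7_mul_B, ← mul_assoc,
    vecMulVec_mul, vecMul_transpose, hb]

theorem pair_comm (a b : Spinor8) : d.pair a b = d.pair b a := by
  rw [pair, pair, dotProduct_mulVec, dotProduct_comm, ← mulVec_transpose, d.B_symm]

theorem pair_mulVec_of_transpose_mul_B {τ : ℂ} {M : Matrix (Fin 8) (Fin 8) ℂ}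
    (hM : Mᵀ * d.B = τ • (d.B * M)) (a b : Spinor8) :
    d.pair a (M *ᵥ b) = τ * d.pair b (M *ᵥ a) := by
  rw [pair_comm, pair, pair, dotProduct_mulVec, ← vecMul_transpose, vecMul_vecMul, hM,
    ← dotProduct_mulVec, smul_mulVec, dotProduct_smul, smul_eq_mul, mulVec_mulVec]

theorem conjS_smul (a : ℂ) (t : Spinor8) : d.conjS (a • t) = (starRingEnd ℂ) a • d.conjS t := by
  rw [conjS, conjS, ← mulVec_smul]
  congr 1
  ext i
  simp

theorem conjS_add (t u : Spinor8) : d.conjS (t + u) = d.conjS t + d.conjS u := by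
  rw [conjS, conjS, conjS, ← mulVec_add]
  congr 1
  ext i
  simp

theorem conjS_zero : d.conjS 0 = 0 := by
  simpa using d.conjS_smul 0 0

section RealSpinor

variable {d} {s : Fin 2 → Spinor8}

theorem IsS.zero_ne_zero (hs : d.IsS s) (hnz : s ≠ 0) : s 0 ≠ 0 := by
  intro h0
  refine hnz (funext fun A => ?_)
  fin_cases A
  · exact h0
  · exact hs.2.1.symm.trans (by rw [h0, conjS_zero]; rfl)

theorem IsS.coeff_eq_zero (hs : d.IsS s) (hnz : s ≠ 0) {a b : ℂ}
    (h : a • s 0 + b • s 1 = 0) : a = 0 ∧ b = 0 := by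
  have h' := congrArg d.conjS h
  rw [conjS_add, conjS_smul, conjS_smul, conjS_zero, hs.2.1, hs.2.2] at h'
  have h'' : (starRingEnd ℂ a * a + starRingEnd ℂ b * b) • s 0 = 0 := by
    linear_combination (norm := module) (starRingEnd ℂ a) • h - b • h'
  have hab := (smul_eq_zero.mp h'').resolve_right (hs.zero_ne_zero hnz)
  rw [← Complex.normSq_eq_conj_mul_self, ← Complex.normSq_eq_conj_mul_self] at hab
  have hab' : Complex.normSq a + Complex.normSq b = 0 := by exact_mod_cast hab
  have ha := Complex.normSq_nonneg a
  have hb := Complex.normSq_nonneg b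
  exact ⟨Complex.normSq_eq_zero.mp (by linarith), Complex.normSq_eq_zero.mp (by linarith)⟩

theorem eq_zero_of_mul_B {X : Matrix (Fin 8) (Fin 8) ℂ} (h : X * d.B = 0) : X = 0 :=
  d.B_nondeg.mul_left_eq_zero.mp h

theorem kappa_eq (s : Fin 2 → Spinor8) (μ : Fin 6) :
    d.kappa s μ = ηd μ * (d.pair (s 0) (d.Γ μ *ᵥ s 1) - d.pair (s 1) (d.Γ μ *ᵥ s 0)) := by
  simp only [kappa, ΓU, pair, epsS, Fin.sum_univ_two, smul_mulVec, mulVec_smul, dotProduct_smul,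
    smul_eq_mul]
  simp
  ring

/-- The antisymmetrised bispinor `ε_{AB} s^A s̄^B`. -/
def skewOuter (d : CliffordData) (s : Fin 2 → Spinor8) : Matrix (Fin 8) (Fin 8) ℂ :=
  d.outer (s 0) (s 1) - d.outer (s 1) (s 0)

theorem trace_skewOuter_mul_Γ (s : Fin 2 → Spinor8) (μ : Fin 6) :
    (d.skewOuter s * d.Γ μ).trace = -(ηd μ * d.kappa s μ) := by
  rw [skewOuter, sub_mul, trace_sub, trace_outer_mul, trace_outer_mul, kappa_eq, ← mul_assoc,
    ηd_mul_self]
  ring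

theorem transpose_skewOuter_mul_B (s : Fin 2 → Spinor8) :
    (d.skewOuter s)ᵀ * d.B = -(d.B * d.skewOuter s) := by
  rw [skewOuter, transpose_sub, sub_mul, transpose_outer_mul_B, transpose_outer_mul_B, mul_sub,
    neg_sub]

theorem IsS.Γ7_mul_skewOuter (hs : d.IsS s) : d.Γ7 * d.skewOuter s = d.skewOuter s := by
  rw [skewOuter, mul_sub, d.Γ7_mul_outer (hs.1 0), d.Γ7_mul_outer (hs.1 1)]

theorem IsS.skewOuter_mul_Γ7 (hs : d.IsS s) : d.skewOuter s * d.Γ7 = -d.skewOuter s := by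
  rw [skewOuter, sub_mul, d.outer_mul_Γ7 _ (hs.1 0), d.outer_mul_Γ7 _ (hs.1 1), neg_sub_neg,
    neg_sub]

theorem IsS.kappa_ne_zero (hs : d.IsS s) (hnz : s ≠ 0) : d.kappa s ≠ 0 := by
  intro hκ
  have hY : d.skewOuter s = 0 := eq_zero_of_chiral_of_skew hs.Γ7_mul_skewOuter
    hs.skewOuter_mul_Γ7 (transpose_skewOuter_mul_B s) fun μ => by
      rw [trace_skewOuter_mul_Γ, hκ]; simp
  rw [skewOuter, outer, outer, ← sub_mul] at hY
  have hX := eq_zero_of_mul_B hY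
  refine hs.zero_ne_zero hnz (funext fun j => ?_)
  refine neg_eq_zero.mp (hs.coeff_eq_zero hnz (a := s 1 j) (b := -s 0 j) (funext fun i => ?_)).2
  have := congrFun (congrFun hX i) j
  simp only [Matrix.sub_apply, vecMulVec_apply, Matrix.zero_apply] at this
  simp only [Pi.add_apply, Pi.smul_apply, smul_eq_mul, Pi.zero_apply]
  linear_combination this

/-- Clifford multiplication by the vector with components `v^μ`. -/
def slash (d : CliffordData) (v : Fin 6 → ℂ) : Matrix (Fin 8) (Fin 8) ℂ := ∑ μ, v μ • d.Γ μ

theorem slash_mul_slash (v : Fin 6 → ℂ) :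
    d.slash v * d.slash v = (∑ μ, (ηd μ : ℂ) * v μ * v μ) • 1 := by
  have h : (2 : ℂ) • (d.slash v * d.slash v) =
      (2 : ℂ) • (∑ μ, (ηd μ : ℂ) * v μ * v μ) • (1 : Matrix (Fin 8) (Fin 8) ℂ) := by
    have e : d.slash v * d.slash v = ∑ μ, ∑ ν, (v μ * v ν) • (d.Γ μ * d.Γ ν) := by
      simp only [slash, Finset.sum_mul_sum, smul_mul_smul_comm]
    have e' : d.slash v * d.slash v = ∑ μ, ∑ ν, (v μ * v ν) • (d.Γ ν * d.Γ μ) := by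
      rw [e, Finset.sum_comm]
      simp only [mul_comm]
    rw [two_smul]
    nth_rw 1 [e]
    rw [e', ← Finset.sum_add_distrib]
    simp only [← Finset.sum_add_distrib, ← smul_add, d.clifford, smul_smul, Finset.sum_smul,
      Finset.smul_sum]
    refine Finset.sum_congr rfl fun μ _ => ?_
    rw [Finset.sum_eq_single μ (fun ν _ h => by simp [h.symm]) (by simp), if_pos rfl]
    congr 1
    ring
  exact smul_right_injective _ (two_ne_zero (α := ℂ)) h

theorem slash_mul_Γ7 (v : Fin 6 → ℂ) : d.slash v * d.Γ7 = -(d.Γ7 * d.slash v) := by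
  simp only [slash, Finset.sum_mul, Finset.mul_sum, smul_mul_assoc, mul_smul_comm, Γ_mul_Γ7,
    smul_neg, Finset.sum_neg_distrib]

theorem transpose_slash_mul_B (v : Fin 6 → ℂ) : (d.slash v)ᵀ * d.B = -(d.B * d.slash v) := by
  simp only [slash, transpose_sum, transpose_smul, Finset.sum_mul, Finset.mul_sum, smul_mul_assoc,
    mul_smul_comm, d.B_skew, smul_neg, Finset.sum_neg_distrib]

theorem trace_Γ_mul_Γ (μ ν : Fin 6) :
    (d.Γ μ * d.Γ ν).trace = if μ = ν then 8 * (ηd μ : ℂ) else 0 := by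
  have h := congrArg trace (d.clifford μ ν)
  rw [trace_add, trace_mul_comm (d.Γ ν), trace_smul, trace_one] at h
  split_ifs at h ⊢
  · simp at h
    linear_combination h / 2
  · simpa using h

theorem trace_Γ_mul_Γ7_mul_Γ (μ ν : Fin 6) : (d.Γ μ * d.Γ7 * d.Γ ν).trace = 0 := by
  obtain ⟨ρ, h₁, h₂⟩ : ∃ ρ : Fin 6, ρ ≠ μ ∧ ρ ≠ ν := by revert μ ν; decide
  refine trace_eq_zero_of_anticomm (d.isUnit_Γ ρ) ?_
  have h (i) (hi : ρ ≠ i) : d.Γ ρ * d.Γ i = (-1 : ℂ) • (d.Γ i * d.Γ ρ) := by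
    rw [d.Γ_anticomm hi, neg_one_smul]
  rw [mul_mul_sign_comm (mul_mul_sign_comm (h μ h₁)
    ((d.Γ_mul_Γ7 ρ).trans (neg_one_smul ℂ _).symm)) (h ν h₂)]
  simp

theorem trace_slash_mul_chiral_mul_Γ (v : Fin 6 → ℂ) (ν : Fin 6) :
    (d.slash v * (1 - d.Γ7) * d.Γ ν).trace = 8 * (ηd ν * v ν) := by
  simp only [slash, Finset.sum_mul, mul_sub, sub_mul, smul_mul_assoc, mul_one, trace_sum,
    trace_sub, trace_smul, trace_Γ_mul_Γ, trace_Γ_mul_Γ7_mul_Γ, smul_eq_mul]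
  simp
  ring

/-- The Fierz identity for the antisymmetrised bispinor. -/
theorem IsS.fierz_skewOuter (hs : d.IsS s) :
    (8 : ℂ) • d.skewOuter s + d.slash (d.kappa s) * (1 - d.Γ7) = 0 := by
  set K := d.slash (d.kappa s)
  refine eq_zero_of_chiral_of_skew (d := d) ?_ ?_ ?_ fun μ => ?_
  · rw [mul_add, mul_smul_comm, hs.Γ7_mul_skewOuter, ← mul_assoc, ← neg_neg (d.Γ7 * K),
      ← slash_mul_Γ7, neg_mul, mul_assoc, mul_sub, Γ7_sq, mul_one, ← mul_neg, neg_sub]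
  · rw [add_mul, smul_mul_assoc, hs.skewOuter_mul_Γ7, mul_assoc, sub_mul, Γ7_sq, one_mul, neg_add,
      smul_neg, ← mul_neg, neg_sub]
  · have h7 : (1 - d.Γ7)ᵀ * d.B = d.B * (1 + d.Γ7) := by
      rw [transpose_sub, sub_mul, transpose_Γ7_mul_B, transpose_one]; noncomm_ring
    have h7' : (1 + d.Γ7) * K = K * (1 - d.Γ7) := by
      rw [mul_sub, slash_mul_Γ7]; noncomm_ring
    rw [transpose_add, add_mul, transpose_smul, smul_mul_assoc, transpose_skewOuter_mul_B,
      transpose_mul, mul_assoc, transpose_slash_mul_B, mul_neg, ← mul_assoc, h7, mul_assoc, h7',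
      mul_add, mul_smul_comm, neg_add, smul_neg]
  · rw [add_mul, trace_add, smul_mul_assoc, trace_smul, trace_skewOuter_mul_Γ,
      trace_slash_mul_chiral_mul_Γ, smul_eq_mul]
    ring

theorem pair_slash_mulVec (a b : Spinor8) (v : Fin 6 → ℂ) :
    d.pair a (d.slash v *ᵥ b) = ∑ μ, v μ * d.pair a (d.Γ μ *ᵥ b) := by
  simp only [pair, slash, sum_mulVec, smul_mulVec, mulVec_sum, mulVec_smul, dotProduct_sum,
    dotProduct_smul, smul_eq_mul]

theorem IsS.kappa_null (hs : d.IsS s) (hnz : s ≠ 0) :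
    ∑ μ, (ηd μ : ℂ) * d.kappa s μ * d.kappa s μ = 0 := by
  set q := ∑ μ, (ηd μ : ℂ) * d.kappa s μ * d.kappa s μ with hq
  set K := d.slash (d.kappa s) with hK
  have hskew := d.pair_mulVec_of_transpose_mul_B (τ := -1) (M := K)
    (by simpa using transpose_slash_mul_B (d.kappa s))
  have h00 : d.pair (s 0) (K *ᵥ s 0) = 0 := by linear_combination hskew (s 0) (s 0) / 2
  have hdiff : d.pair (s 0) (K *ᵥ s 1) - d.pair (s 1) (K *ᵥ s 0) = q := by
    rw [hK, pair_slash_mulVec, pair_slash_mulVec, ← Finset.sum_sub_distrib, hq]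
    refine Finset.sum_congr rfl fun μ _ => ?_
    have hη := ηd_mul_self μ
    have hκ := d.kappa_eq s μ
    linear_combination (-d.kappa s μ) * (ηd μ * hκ) - d.kappa s μ *
      (d.pair (s 0) (d.Γ μ *ᵥ s 1) - d.pair (s 1) (d.Γ μ *ᵥ s 0)) * hη
  have h10 : d.pair (s 1) (K *ᵥ s 0) = -q / 2 := by
    linear_combination (hskew (s 0) (s 1) - hdiff) / 2
  have hchi : (1 - d.Γ7) *ᵥ K *ᵥ s 0 = (2 : ℂ) • K *ᵥ s 0 := by
    have h7 : d.Γ7 * K = -(K * d.Γ7) := by rw [slash_mul_Γ7, neg_neg]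
    have hp : d.Γ7 *ᵥ s 0 = s 0 := hs.1 0
    rw [sub_mulVec, one_mulVec, mulVec_mulVec, h7, neg_mulVec, ← mulVec_mulVec, hp,
      sub_neg_eq_add, two_smul]
  have h := congrArg (· *ᵥ K *ᵥ s 0) hs.fierz_skewOuter
  simp only [add_mulVec, smul_mulVec, zero_mulVec, skewOuter, sub_mulVec, outer_mulVec, h00, h10,
    zero_smul, sub_zero] at h
  rw [← mulVec_mulVec, hchi, mulVec_smul, mulVec_mulVec, slash_mul_slash, smul_mulVec, one_mulVec,
    ← hq, smul_smul, smul_smul, ← add_smul, smul_eq_zero] at h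
  linear_combination (-1 / 2) * h.resolve_right (hs.zero_ne_zero hnz)

theorem Γ3_eq {μ ν ρ : Fin 6} (h₁ : μ ≠ ν) (h₂ : μ ≠ ρ) (h₃ : ν ≠ ρ) :
    d.Γ3 μ ν ρ = d.Γ μ * d.Γ ν * d.Γ ρ := by
  have e₁ : d.Γ μ * d.Γ ρ * d.Γ ν = -(d.Γ μ * d.Γ ν * d.Γ ρ) := by
    rw [mul_assoc, d.Γ_anticomm h₃.symm, mul_neg, mul_assoc]
  have e₂ : d.Γ ν * d.Γ μ * d.Γ ρ = -(d.Γ μ * d.Γ ν * d.Γ ρ) := by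
    rw [d.Γ_anticomm h₁.symm, neg_mul]
  have e₃ : d.Γ ν * d.Γ ρ * d.Γ μ = d.Γ μ * d.Γ ν * d.Γ ρ := by
    rw [mul_assoc, d.Γ_anticomm h₂.symm, mul_neg, ← mul_assoc, e₂, neg_neg]
  have e₄ : d.Γ ρ * d.Γ μ * d.Γ ν = d.Γ μ * d.Γ ν * d.Γ ρ := by
    rw [d.Γ_anticomm h₂.symm, neg_mul, e₁, neg_neg]
  have e₅ : d.Γ ρ * d.Γ ν * d.Γ μ = -(d.Γ μ * d.Γ ν * d.Γ ρ) := by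
    rw [d.Γ_anticomm h₃.symm, neg_mul, e₃]
  rw [Γ3, e₁, e₂, e₃, e₄, e₅]
  module

theorem IsS.omega3_coeff_eq_zero (hs : d.IsS s) (hnz : s ≠ 0) {c₁ c₂ c₃ : ℂ}
    (h : ∀ μ ν ρ, c₁ * d.omega3 s 0 0 μ ν ρ + c₂ * d.omega3 s 0 1 μ ν ρ
      + c₃ * d.omega3 s 1 1 μ ν ρ = 0) : c₁ = 0 ∧ c₂ = 0 ∧ c₃ = 0 := by
  set Y := c₁ • d.outer (s 0) (s 0) + (c₂ / 2) • (d.outer (s 0) (s 1) + d.outer (s 1) (s 0)) +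
    c₃ • d.outer (s 1) (s 1) with hYdef
  have hY : Y = 0 := by
    refine eq_zero_of_chiral_of_symm (d := d) ?_ ?_ ?_ fun μ ν ρ h₁ h₂ h₃ => ?_
    · simp only [hYdef, mul_add, mul_smul_comm, d.Γ7_mul_outer (hs.1 _)]
    · simp only [hYdef, add_mul, smul_mul_assoc, d.outer_mul_Γ7 _ (hs.1 _)]
      module
    · simp only [hYdef, transpose_add, transpose_smul, add_mul, smul_mul_assoc,
        transpose_outer_mul_B, mul_add, mul_smul_comm]
      module
    · have hsymm := d.pair_mulVec_of_transpose_mul_B (τ := 1)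
        ((transpose_Γ_mul_Γ_mul_Γ_mul_B h₁ h₂ h₃).trans (one_smul ℂ _).symm) (s 0) (s 1)
      have h' := h μ ν ρ
      simp only [omega3, Γ3_eq h₁ h₂ h₃] at h'
      simp only [hYdef, add_mul, smul_mul_assoc, trace_add, trace_smul, trace_outer_mul,
        smul_eq_mul]
      linear_combination h' - c₂ / 2 * hsymm
  have hX : c₁ • vecMulVec (s 0) (s 0) +
      (c₂ / 2) • (vecMulVec (s 0) (s 1) + vecMulVec (s 1) (s 0)) +
      c₃ • vecMulVec (s 1) (s 1) = 0 :=
    eq_zero_of_mul_B (d := d) (by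
      simpa only [hYdef, outer, add_mul, smul_mul_assoc] using hY)
  have hj (j) := hs.coeff_eq_zero hnz (a := c₁ * s 0 j + c₂ / 2 * s 1 j)
    (b := c₂ / 2 * s 0 j + c₃ * s 1 j) (funext fun i => by
      have := congrFun (congrFun hX i) j
      simp only [Matrix.add_apply, Matrix.smul_apply, vecMulVec_apply, Matrix.zero_apply, smul_eq_mul] at this
      simp only [Pi.add_apply, Pi.smul_apply, smul_eq_mul, Pi.zero_apply]
      linear_combination this)
  have h₁ := hs.coeff_eq_zero hnz (a := c₁) (b := c₂ / 2) (funext fun j => (hj j).1)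
  have h₂ := hs.coeff_eq_zero hnz (a := c₂ / 2) (b := c₃) (funext fun j => (hj j).2)
  exact ⟨h₁.1, by linear_combination 2 * h₁.2, h₂.2⟩

end RealSpinor

end CliffordData

/-- Let `s ∈ S` be non-zero, with Dirac current `κ`
(`κ^μ = ε_{AB} s̄^A Γ^μ s^B`) and 3-forms `ω^{AB}`
(`ω_{μνρ}{}^{AB} = s̄^A Γ_{μνρ} s^B`).  Then (i) `κ` is a non-vanishing null
vector, and (ii) the 3-forms `ω^{11}, ω^{12}, ω^{22}` are linearly independent;
in particular none of them vanishes. -/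
theorem dirac_current_null_and_omega_linearly_independent (d : CliffordData)
    (s : Fin 2 → Spinor8) (hs : d.IsS s) (hnz : s ≠ 0) :
    (d.kappa s ≠ 0 ∧ ∑ μ, (ηd μ : ℂ) * d.kappa s μ * d.kappa s μ = 0) ∧
    (∀ c₁ c₂ c₃ : ℂ,
       (∀ μ ν ρ, c₁ * d.omega3 s 0 0 μ ν ρ + c₂ * d.omega3 s 0 1 μ ν ρ
          + c₃ * d.omega3 s 1 1 μ ν ρ = 0) → c₁ = 0 ∧ c₂ = 0 ∧ c₃ = 0) := by
  exact ⟨⟨hs.kappa_ne_zero hnz, hs.kappa_null hnz⟩, fun _ _ _ => hs.omega3_coeff_eq_zero hnz⟩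
end
end
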